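/- (Theorem 2, Characterization) A choice rule π has a RAM representation if and only if the relation P has no cycle (i.e., there is no finite sequence a_1, a_2, …, a_n with a_1 P a_2, a_2 P a_3, …, a_{n−1} P a_n, and a_n P a_1). -/

import Mathlib

open Finset
open scoped Classical

variable {α : Type*} [Fintype α] [DecidableEq α]

/-- A choice rule: for every choice problem (nonempty finite set) `S`,
`π S` is a probability distribution supported on `S`. -/
def IsChoiceRule (π : Finset α → α → ℝ) : Prop :=
  ∀ S : Finset α, S.Nonempty →
    (∀ a ∈ S, 0 ≤ π S a) ∧ (∀ a, a ∉ S → π S a = 0) ∧ (∑ a ∈ S, π S a) = 1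

/-- An attention rule: for every choice problem `S`, `μ S` is a probability
distribution over the nonempty subsets of `S`.  `μ S T` is the probability of
paying attention to the consideration set `T` when the choice problem is `S`. -/
def IsAttentionRule (μ : Finset α → Finset α → ℝ) : Prop :=
  ∀ S : Finset α, S.Nonempty →
    (∀ T : Finset α, T ⊆ S → T.Nonempty → 0 ≤ μ S T) ∧
    (∀ T : Finset α, ¬(T ⊆ S ∧ T.Nonempty) → μ S T = 0) ∧
    (∑ T ∈ S.powerset, μ S T) = 1

/-- Assumption 1 (Monotonic attention): `μ(T|S) ≤ μ(T|S−a)` for `a ∈ S − T`. -/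
def MonotonicAttention (μ : Finset α → Finset α → ℝ) : Prop :=
  ∀ S T : Finset α, S.Nonempty → T ⊆ S → T.Nonempty →
    ∀ a ∈ S, a ∉ T → μ S T ≤ μ (S.erase a) T

/-- A preference: a strict linear order (asymmetric, transitive, complete). -/
structure IsPref (r : α → α → Prop) : Prop where
  asymm : ∀ a b, r a b → ¬ r b a
  trans : ∀ a b c, r a b → r b c → r a c
  total : ∀ a b, a ≠ b → r a b ∨ r b a

/-- `a` is the `r`-maximal element of `T`. -/
def IsBest (r : α → α → Prop) (a : α) (T : Finset α) : Prop :=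
  a ∈ T ∧ ∀ b ∈ T, b ≠ a → r a b

/-- `(r, μ)` represents `π` (without the monotonicity requirement on `μ`):
`π(a|S) = Σ_{T ⊆ S} 1(a is r-best in T) μ(T|S)`. -/
noncomputable def Represents (π : Finset α → α → ℝ) (r : α → α → Prop)
    (μ : Finset α → Finset α → ℝ) : Prop :=
  IsChoiceRule π ∧ IsPref r ∧ IsAttentionRule μ ∧
  ∀ S : Finset α, S.Nonempty → ∀ a ∈ S,
    π S a = ∑ T ∈ S.powerset, if IsBest r a T then μ S T else 0

/-- `(r, μ)` is a RAM representation of `π`: a representation with `μ` monotonic. -/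
def IsRAM (π : Finset α → α → ℝ) (r : α → α → Prop)
    (μ : Finset α → Finset α → ℝ) : Prop :=
  Represents π r μ ∧ MonotonicAttention μ

/-- The revealed-preference relation `P`: `a P b` iff `a ≠ b` and there is a
choice problem `S` containing `a` and `b` with `π(a|S) > π(a|S−b)`. -/
def Prel (π : Finset α → α → ℝ) (a b : α) : Prop :=
  a ≠ b ∧ ∃ S : Finset α, a ∈ S ∧ b ∈ S ∧ π S a > π (S.erase b) a

/-- Lower contour set of `a` with respect to the preference `r`. -/
noncomputable def lowerContour (r : α → α → Prop) (a : α) : Finset α :=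
  Finset.univ.filter fun b => b = a ∨ r a b

/-- An attention rule is triangular w.r.t. `r` if it puts weight only on
(intersections of `S` with) lower contour sets. -/
def Triangular (r : α → α → Prop) (μ : Finset α → Finset α → ℝ) : Prop :=
  ∀ S T : Finset α, S.Nonempty → 0 < μ S T → ∃ a ∈ S, T = lowerContour r a ∩ S

/-- A (deterministic) attention filter. -/
def IsAttentionFilter (Γ : Finset α → Finset α) : Prop :=
  ∀ S : Finset α, S.Nonempty →
    Γ S ⊆ S ∧ (Γ S).Nonempty ∧
    ∀ a ∈ S, a ∉ Γ S → (S.erase a).Nonempty → Γ (S.erase a) = Γ S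

/-- An attention filter is triangular w.r.t. `r` if each `Γ(S)` is the
intersection of `S` with a lower contour set of some element of `S`. -/
def TriangularFilter (r : α → α → Prop) (Γ : Finset α → Finset α) : Prop :=
  ∀ S : Finset α, S.Nonempty → ∃ a ∈ S, Γ S = lowerContour r a ∩ S

/-- Assumption 3 (φ-attentive at binaries). -/
def AttentiveAtBinaries (φ : ℝ) (μ : Finset α → Finset α → ℝ) : Prop :=
  ∀ a b : α, a ≠ b →
    μ {a, b} {a, b} ≥ (1 - φ) / φ * max (μ {a, b} {a}) (μ {a, b} {b})

/-- A deterministic attention rule. -/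
def Deterministic (μ : Finset α → Finset α → ℝ) : Prop :=
  ∀ S T : Finset α, S.Nonempty → μ S T = 0 ∨ μ S T = 1

/-- Under a RAM representation, `Prel π` is contained in the preference. -/
theorem IsRAM.pref_of_prel {β : Type*} [DecidableEq β] {π : Finset β → β → ℝ}
    {r : β → β → Prop} {μ : Finset β → Finset β → ℝ} (h : IsRAM π r μ) {a b : β} (hab : Prel π a b) :
    r a b := by
  obtain ⟨⟨-, hr, hμ, hrep⟩, hmono⟩ := h
  obtain ⟨hne, S, ha, hb, hlt⟩ := hab
  refine (hr.total a b hne).resolve_right fun hba => hlt.not_ge ?_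
  have hS : S.Nonempty := ⟨a, ha⟩
  have ha' : a ∈ S.erase b := mem_erase.2 ⟨hne, ha⟩
  rw [hrep S hS a ha, hrep (S.erase b) ⟨a, ha'⟩ a ha',
    ← sum_filter (fun T => IsBest r a T), ← sum_filter (fun T => IsBest r a T)]
  have notMem : ∀ T, IsBest r a T → b ∉ T := fun T hT hbT =>
    hr.asymm _ _ hba (hT.2 b hbT hne.symm)
  refine (sum_le_sum (g := fun T => μ (S.erase b) T) fun T hT => ?_).trans
    (sum_le_sum_of_subset_of_nonneg (fun T hT => ?_) fun T hT _ => ?_)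
  · rw [mem_filter, mem_powerset] at hT
    exact hmono S T hS hT.1 ⟨a, hT.2.1⟩ b hb (notMem T hT.2)
  · rw [mem_filter, mem_powerset] at hT ⊢
    exact ⟨subset_erase.2 ⟨hT.1, notMem T hT.2⟩, hT.2⟩
  · rw [mem_filter, mem_powerset] at hT
    exact (hμ _ ⟨a, ha'⟩).1 T hT.1 ⟨a, hT.2.1⟩

/-- A relation without cycles extends to a preference. -/
theorem exists_isPref_of_acyclic {β : Type*} {p : β → β → Prop}
    (hp : ∀ a, ¬ Relation.TransGen p a a) :
    ∃ r : β → β → Prop, IsPref r ∧ ∀ a b, p a b → r a b := by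
  have : IsPartialOrder β (Relation.ReflTransGen p) :=
    { refl := fun _ => .refl
      trans := fun _ _ _ => .trans
      antisymm := fun a b hab hba => by
        rcases Relation.reflTransGen_iff_eq_or_transGen.1 hab with h | h
        · exact h.symm
        · exact (hp a (h.trans_left hba)).elim }
  obtain ⟨s, hs, hle⟩ := extend_partialOrder (Relation.ReflTransGen p)
  refine ⟨fun a b => s a b ∧ a ≠ b, ⟨?_, ?_, ?_⟩, ?_⟩
  · exact fun a b hab hba => hab.2 (hs.antisymm a b hab.1 hba.1)
  · refine fun a b c hab hbc => ⟨hs.trans a b c hab.1 hbc.1, ?_⟩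
    rintro rfl
    exact hab.2 (hs.antisymm a b hab.1 hbc.1)
  · exact fun a b hab => (hs.total a b).imp (fun h => ⟨h, hab⟩) fun h => ⟨h, hab.symm⟩
  · refine fun a b hab => ⟨hle a b (.single hab), ?_⟩
    rintro rfl
    exact hp a (.single hab)

/-- The attention rule that, at `S`, considers the part of `S` in the lower contour set
of `a` with probability `π S a`. -/
noncomputable def contourAttention (π : Finset α → α → ℝ) (r : α → α → Prop)
    (S T : Finset α) : ℝ :=
  ∑ a ∈ S, if T = lowerContour r a ∩ S then π S a else 0

theorem mem_lowerContour {r : α → α → Prop} {a b : α} :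
    b ∈ lowerContour r a ↔ b = a ∨ r a b := by
  simp [lowerContour]

theorem IsPref.isBest_lowerContour_inter_iff {r : α → α → Prop} (hr : IsPref r)
    {S : Finset α} {a b : α} (hb : b ∈ S) :
    IsBest r a (lowerContour r b ∩ S) ↔ a = b := by
  simp only [IsBest, mem_inter, mem_lowerContour]
  constructor
  · rintro ⟨⟨hab | hba, -⟩, h⟩
    · exact hab
    · by_contra hne
      exact hr.asymm _ _ hba (h b ⟨Or.inl rfl, hb⟩ (Ne.symm hne))
  · rintro rfl
    exact ⟨⟨Or.inl rfl, hb⟩, fun c hc hne => hc.1.resolve_left hne⟩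

theorem isAttentionRule_contourAttention {π : Finset α → α → ℝ} (hπ : IsChoiceRule π)
    (r : α → α → Prop) : IsAttentionRule (contourAttention π r) := by
  intro S hS
  refine ⟨fun T _ _ => sum_nonneg fun a ha => ?_, fun T hT => sum_eq_zero fun a ha => ?_, ?_⟩
  · split_ifs
    · exact (hπ S hS).1 a ha
    · exact le_rfl
  · refine if_neg ?_
    rintro rfl
    exact hT ⟨inter_subset_right, a, mem_inter.2 ⟨mem_lowerContour.2 (Or.inl rfl), ha⟩⟩
  · simp only [contourAttention]
    rw [sum_comm, ← (hπ S hS).2.2]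
    refine sum_congr rfl fun a _ => ?_
    rw [sum_ite_eq', if_pos (mem_powerset.2 inter_subset_right)]

theorem represents_contourAttention {π : Finset α → α → ℝ} (hπ : IsChoiceRule π)
    {r : α → α → Prop} (hr : IsPref r) : Represents π r (contourAttention π r) := by
  refine ⟨hπ, hr, isAttentionRule_contourAttention hπ r, fun S _ a ha => ?_⟩
  rw [← sum_filter (fun T => IsBest r a T)]
  simp only [contourAttention]
  rw [sum_comm]
  simp only [sum_ite_eq', mem_filter, mem_powerset, inter_subset_right, true_and]
  rw [sum_congr rfl fun b hb =>
    if_congr (hr.isBest_lowerContour_inter_iff (a := a) hb) rfl rfl]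
  rw [sum_ite_eq, if_pos ha]

theorem monotonicAttention_contourAttention {π : Finset α → α → ℝ} (hπ : IsChoiceRule π)
    {r : α → α → Prop} (hP : ∀ a b, Prel π a b → r a b) :
    MonotonicAttention (contourAttention π r) := by
  intro S T _ _ _ a ha haT
  have hself : T ≠ lowerContour r a ∩ S := by
    rintro rfl
    exact haT (mem_inter.2 ⟨mem_lowerContour.2 (Or.inl rfl), ha⟩)
  simp only [contourAttention]
  rw [← add_sum_erase S _ ha, if_neg hself, zero_add]
  refine sum_le_sum fun b hb => ?_
  obtain ⟨hba, hbS⟩ := mem_erase.1 hb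
  by_cases hT : T = lowerContour r b ∩ S
  · have hT' : T = lowerContour r b ∩ S.erase a := by
      rw [inter_erase, ← hT, erase_eq_of_notMem haT]
    rw [if_pos hT, if_pos hT']
    by_contra! hlt
    refine haT (hT ▸ mem_inter.2 ⟨mem_lowerContour.2 (Or.inr ?_), ha⟩)
    exact hP b a ⟨hba, S, hbS, ha, hlt⟩
  · rw [if_neg hT]
    split_ifs
    · exact (hπ _ ⟨b, hb⟩).1 b hb
    · exact le_rfl

/-- Theorem 2, Characterization: A choice rule `π` has a RAM
representation iff the relation `P` has no cycle (equivalently, the transitive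
closure of `P` is irreflexive). -/
theorem stmt4 (π : Finset α → α → ℝ) (hπ : IsChoiceRule π) :
    (∃ (r : α → α → Prop) (μ : Finset α → Finset α → ℝ), IsRAM π r μ) ↔
      ∀ a : α, ¬ Relation.TransGen (Prel π) a a := by
  constructor
  · rintro ⟨r, μ, h⟩ a ha
    have hr : IsPref r := h.1.2.1
    have hra : r a a := by
      have key : ∀ b, Relation.TransGen (Prel π) a b → r a b := fun b hab => by
        induction hab with
        | single h₁ => exact h.pref_of_prel h₁
        | tail _ h₂ ih => exact hr.trans _ _ _ ih (h.pref_of_prel h₂)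
      exact key a ha
    exact hr.asymm a a hra hra
  · intro hacyclic
    obtain ⟨r, hr, hP⟩ := exists_isPref_of_acyclic hacyclic
    exact ⟨r, contourAttention π r, represents_contourAttention hπ hr,
      monotonicAttention_contourAttention hπ hP⟩
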